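/- Let h = 2n+1 be an odd integer with n ≥ 1, let τ be an h-bar-core, and let λ, μ ∈ P_{τ,2} with bar positions a(λ) ≤ b(λ) and a(μ) ≤ b(μ). If a(λ) ≤ a(μ) and b(λ) ≤ b(μ), then λ ⊴ μ. -/

import Mathlib

/-- A partition: a weakly decreasing sequence of non-negative integers with
finite sum (finitely many nonzero parts), indexed from 0 (so `parts 0` is λ₁). -/
structure BPartition where
  parts : ℕ →₀ ℕ
  antitone : ∀ r, parts (r + 1) ≤ parts r

namespace BPartition

/-- The multiset of positive parts of a partition. -/
def partsM (lam : BPartition) : Multiset ℕ :=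
  lam.parts.support.val.map (fun r => lam.parts r)

/-- The Young diagram: nodes `(r, c)` with rows indexed from 0 and columns from 1. -/
def diagram (lam : BPartition) : Set (ℕ × ℕ) :=
  {x | 1 ≤ x.2 ∧ x.2 ≤ lam.parts x.1}

/-- A partition is strict if λ_r > λ_{r+1} whenever λ_r > 0. -/
def IsStrict (lam : BPartition) : Prop :=
  ∀ r, 0 < lam.parts r → lam.parts (r + 1) < lam.parts r

/-- A partition is h-strict if each part is either strictly bigger than the next,
or positive and divisible by h, or zero. -/
def IsHStrict (h : ℕ) (lam : BPartition) : Prop :=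
  ∀ r, lam.parts (r + 1) < lam.parts r ∨ (0 < lam.parts r ∧ h ∣ lam.parts r) ∨ lam.parts r = 0

/-- An h-strict partition is restricted if for every r either λ_{r+1} > λ_r − h,
or λ_{r+1} = λ_r − h and h does not divide λ_r. -/
def IsRestricted (h : ℕ) (lam : BPartition) : Prop :=
  ∀ r, lam.parts r < lam.parts (r + 1) + h ∨
    (lam.parts (r + 1) + h = lam.parts r ∧ ¬ h ∣ lam.parts r)

/-- The residue of a node in column c (1-indexed): the smaller of the residues of
c − 1 and of −c modulo h. -/
def colRes (h c : ℕ) : ℕ := min ((c - 1) % h) ((h - c % h) % h)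

/-- `x` is an addable i-node of `lam`. -/
def Addable (h i : ℕ) (lam : BPartition) (x : ℕ × ℕ) : Prop :=
  colRes h x.2 = i ∧ x ∉ diagram lam ∧
  ∃ nu : BPartition, IsHStrict h nu ∧ diagram lam ⊆ diagram nu ∧ x ∈ diagram nu ∧
    ∀ y ∈ diagram nu, y ∉ diagram lam → colRes h y.2 = i

/-- `x` is a removable i-node of `lam`. -/
def Removable (h i : ℕ) (lam : BPartition) (x : ℕ × ℕ) : Prop :=
  x ∈ diagram lam ∧
  ∃ mu : BPartition, IsHStrict h mu ∧ diagram mu ⊆ diagram lam ∧ x ∉ diagram mu ∧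
    ∀ y ∈ diagram lam, y ∉ diagram mu → colRes h y.2 = i

/-- Removal of a single h-bar from `lam` giving `mu`, recording the value `v`:
either a part `v ≥ h` is replaced by `v − h` (deleted if `v = h`), or two parts
summing to `h` are deleted, in which case `v` is the larger of the two. -/
def barStepRec (h : ℕ) (lam mu : BPartition) (v : ℕ) : Prop :=
  IsHStrict h mu ∧
  ((v = h ∧ v ∈ partsM lam ∧ partsM mu = (partsM lam).erase v) ∨
   (h < v ∧ v ∈ partsM lam ∧ partsM mu = (v - h) ::ₘ (partsM lam).erase v) ∨
   (∃ a b : ℕ, a + b = h ∧ a ∈ partsM lam ∧ b ∈ (partsM lam).erase a ∧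
      v = max a b ∧ partsM mu = ((partsM lam).erase a).erase b))

/-- Removal of a single h-bar. -/
def barStep (h : ℕ) (lam mu : BPartition) : Prop :=
  ∃ v, barStepRec h lam mu v

/-- An h-bar-core: an h-strict partition from which no h-bar can be removed. -/
def IsBarCore (h : ℕ) (lam : BPartition) : Prop :=
  IsHStrict h lam ∧ ∀ mu, ¬ barStep h lam mu

/-- A chain of `w` h-bar removals from `lam` down to `mu`. -/
def barChain (h : ℕ) : ℕ → BPartition → BPartition → Prop
  | 0, lam, mu => lam = mu
  | w + 1, lam, mu => ∃ nu, barStep h lam nu ∧ barChain h w nu mu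

/-- `lam ∈ P_{τ,w}`: `lam` is h-strict with h-bar-core `tau` and h-bar-weight `w`. -/
def InBlock (h : ℕ) (tau : BPartition) (w : ℕ) (lam : BPartition) : Prop :=
  IsHStrict h lam ∧ IsBarCore h tau ∧ barChain h w lam tau

/-- The left-to-right order on node positions along the edge of a Young diagram:
smaller column first; within a column, larger row first. -/
def posLE (x y : ℕ × ℕ) : Prop := x.2 < y.2 ∨ (x.2 = y.2 ∧ y.1 ≤ x.1)

/-- `x` is a normal i-node: a removable i-node surviving (as a − sign) in the
reduced i-signature; equivalently, every window of the i-signature ending at `x`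
contains strictly more removable than addable i-nodes. -/
def Normal (h i : ℕ) (lam : BPartition) (x : ℕ × ℕ) : Prop :=
  Removable h i lam x ∧ ∀ z : ℕ × ℕ, posLE z x →
    Set.ncard {y | Addable h i lam y ∧ posLE z y ∧ posLE y x} <
      Set.ncard {y | Removable h i lam y ∧ posLE z y ∧ posLE y x}

/-- `x` is a conormal i-node: an addable i-node surviving (as a + sign) in the
reduced i-signature. -/
def Conormal (h i : ℕ) (lam : BPartition) (x : ℕ × ℕ) : Prop :=
  Addable h i lam x ∧ ∀ z : ℕ × ℕ, posLE x z →
    Set.ncard {y | Removable h i lam y ∧ posLE x y ∧ posLE y z} <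
      Set.ncard {y | Addable h i lam y ∧ posLE x y ∧ posLE y z}

/-- The node set of ψ_i(λ): add the leftmost s − r conormal i-nodes if s ≥ r,
remove the rightmost r − s normal i-nodes if r > s, where r = #normal and
s = #conormal i-nodes. -/
noncomputable def psiSet (h i : ℕ) (lam : BPartition) : Set (ℕ × ℕ) :=
  if Set.ncard {x | Normal h i lam x} ≤ Set.ncard {x | Conormal h i lam x} then
    diagram lam ∪ {x | Conormal h i lam x ∧
      Set.ncard {y | Conormal h i lam y ∧ posLE y x} ≤
        Set.ncard {x | Conormal h i lam x} - Set.ncard {x | Normal h i lam x}}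
  else
    diagram lam \ {x | Normal h i lam x ∧
      Set.ncard {y | Normal h i lam y ∧ posLE x y} ≤
        Set.ncard {x | Normal h i lam x} - Set.ncard {x | Conormal h i lam x}}

open Classical in
/-- The involution ψ_i. -/
noncomputable def psi (h i : ℕ) (lam : BPartition) : BPartition :=
  if hex : ∃ mu : BPartition, diagram mu = psiSet h i lam then hex.choose else lam

/-- The set of occupied positions of the abacus display of a strict partition. -/
def abacus (lam : BPartition) : Set ℤ :=
  {a | a = 0 ∨ (0 < a ∧ a.toNat ∈ partsM lam) ∨ (a < 0 ∧ (-a).toNat ∉ partsM lam)}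

/-- The dominance order: λ ⊴ μ. -/
def domLE (lam mu : BPartition) : Prop :=
  ∀ r, ∑ s ∈ Finset.range r, lam.parts s ≤ ∑ s ∈ Finset.range r, mu.parts s

/-- Strict dominance: λ ◁ μ. -/
def domLT (lam mu : BPartition) : Prop := domLE lam mu ∧ lam ≠ mu

/-- Lexicographic order: λ <lex μ. -/
def lexLT (lam mu : BPartition) : Prop :=
  ∃ r, lam.parts r < mu.parts r ∧ ∀ s < r, lam.parts s = mu.parts s

/-- Colexicographic order: λ <colex μ. -/
def colexLT (lam mu : BPartition) : Prop :=
  ∃ r, mu.parts r < lam.parts r ∧ ∀ s, r < s → lam.parts s = mu.parts s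

/-- λ ↔ᵢ μ: every node of the symmetric difference of the diagrams has residue i. -/
def Link (h i : ℕ) (lam mu : BPartition) : Prop :=
  ∀ x : ℕ × ℕ, x ∈ (diagram lam \ diagram mu) ∪ (diagram mu \ diagram lam) →
    colRes h x.2 = i

/-- `a ≤ b` are the bar positions of `lam ∈ P_{τ,2}`: the values recorded by
some two-step removal of h-bars from `lam` down to `tau`. -/
def BarPositions (h : ℕ) (tau lam : BPartition) (a b : ℕ) : Prop :=
  a ≤ b ∧ ∃ (nu : BPartition) (v₁ v₂ : ℕ), barStepRec h lam nu v₁ ∧ barStepRec h nu tau v₂ ∧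
    ({a, b} : Multiset ℕ) = {v₁, v₂}

/-- The leg length of the bar of `lam ∈ P_{τ,2}` at bar position `c`. -/
noncomputable def legLen (h : ℕ) (tau lam : BPartition) (c : ℕ) : ℕ :=
  if h ≤ c then Set.ncard {x : ℕ | c - h < x ∧ x < c ∧ x ∈ partsM lam ∧ x ∈ partsM tau}
  else (h - c) + Set.ncard {x : ℕ | h - c < x ∧ x < c ∧ x ∈ partsM lam ∧ x ∈ partsM tau}

/-- ∂λ: the absolute difference of the two leg lengths of `lam`, whose bar
positions are `a ≤ b`. -/
noncomputable def ddd (h : ℕ) (tau lam : BPartition) (a b : ℕ) : ℕ :=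
  max (legLen h tau lam a) (legLen h tau lam b) - min (legLen h tau lam a) (legLen h tau lam b)

inductive Colour | black | white | grey
deriving DecidableEq

/-- β(τ): the number of parts of τ less than h. -/
def betaCount (h : ℕ) (tau : BPartition) : ℕ :=
  Multiset.card ((partsM tau).filter (fun x => x < h))

/-- The leg length of a 2h-bar of `lam` with larger bar position `b`. -/
noncomputable def legLen2 (h : ℕ) (tau lam : BPartition) (b : ℕ) : ℕ :=
  if 2 * h ≤ b then Set.ncard {x : ℕ | b - 2 * h < x ∧ x < b ∧ x ∈ partsM lam ∧ x ∈ partsM tau}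
  else (2 * h - b) + Set.ncard {x : ℕ | 2 * h - b < x ∧ x < b ∧ x ∈ partsM lam ∧ x ∈ partsM tau}

/-- The colour of `lam ∈ P_{τ,2}` with bar positions `a ≤ b`. -/
noncomputable def colour (h : ℕ) (tau lam : BPartition) (a b : ℕ) : Colour :=
  if 2 ≤ ddd h tau lam a b then Colour.grey
  else if ddd h tau lam a b = 1 then
    if h < b then Colour.grey
    else if (min (legLen h tau lam a) (legLen h tau lam b) + betaCount h tau) % 2 = 1 then
      Colour.black else Colour.white
  else
    if b = a + h ∨ a + b = 2 * h then
      if (legLen2 h tau lam b + 2 * betaCount h tau) % 4 = 0 ∨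
         (legLen2 h tau lam b + 2 * betaCount h tau) % 4 = 3 then Colour.black
      else Colour.white
    else
      if (legLen h tau lam a + betaCount h tau) % 2 = 1 then Colour.black else Colour.white

end BPartition

namespace BPartition

/-- Sum of the excesses of the parts over `t`. -/
def exc (p : BPartition) (t : ℕ) : ℕ := ((partsM p).map (fun x => x - t)).sum

lemma exc_eq (p : BPartition) (t : ℕ) : exc p t = ∑ s ∈ p.parts.support, (p.parts s - t) := by
  simp [exc, partsM, Multiset.map_map, Function.comp_def]

lemma sum_le_exc (p : BPartition) (t r : ℕ) :
    ∑ s ∈ Finset.range r, p.parts s ≤ exc p t + r * t := by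
  have e1 : ∑ s ∈ Finset.range r, p.parts s ≤ ∑ s ∈ Finset.range r, ((p.parts s - t) + t) :=
    Finset.sum_le_sum (fun s _ => by omega)
  have e2 : ∑ s ∈ Finset.range r, (p.parts s - t) ≤ exc p t := by
    rw [exc_eq]
    apply Finset.sum_le_sum_of_ne_zero
    intro x _ hx
    rw [Finsupp.mem_support_iff]
    intro h0
    apply hx
    simp [h0]
  rw [Finset.sum_add_distrib] at e1
  simp at e1
  omega

lemma exc_le_sum (p : BPartition) (r : ℕ) :
    exc p (p.parts r) + r * p.parts r ≤ ∑ s ∈ Finset.range r, p.parts s := by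
  have anti : Antitone p.parts := antitone_nat_of_succ_le p.antitone
  have e2 : exc p (p.parts r) ≤ ∑ s ∈ Finset.range r, (p.parts s - p.parts r) := by
    rw [exc_eq]
    apply Finset.sum_le_sum_of_ne_zero
    intro x _ hx
    rw [Finset.mem_range]
    by_contra hc
    have := anti (not_lt.mp hc)
    omega
  have e1 : ∑ s ∈ Finset.range r, ((p.parts s - p.parts r) + p.parts r)
      = ∑ s ∈ Finset.range r, p.parts s :=
    Finset.sum_congr rfl (fun s hs => by
      have := anti (Finset.mem_range.mp hs).le
      omega)
  rw [Finset.sum_add_distrib] at e1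
  simp at e1
  omega

lemma domLE_of_exc (p q : BPartition) (H : ∀ t, exc p t ≤ exc q t) : domLE p q := by
  intro r
  have := sum_le_exc p (q.parts r) r
  have := exc_le_sum q r
  have := H (q.parts r)
  omega

lemma sum_erase (M : Multiset ℕ) (f : ℕ → ℕ) (a : ℕ) (ha : a ∈ M) :
    (M.map f).sum = f a + ((M.erase a).map f).sum := by
  conv_lhs => rw [← Multiset.cons_erase ha]
  simp

lemma exc_step (h v : ℕ) (p q : BPartition) (H : barStepRec h p q v) :
    h ≤ 2 * v ∧ ∀ t, exc p t + (v - h - t) = exc q t + (v - t) + (h - v - t) := by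
  obtain ⟨-, ⟨e, hv, hq⟩ | ⟨e, hv, hq⟩ | ⟨a, b, hab, hA, hB, hv, hq⟩⟩ := H
  · refine ⟨by omega, fun t => ?_⟩
    have := sum_erase _ (fun x => x - t) _ hv
    simp only [exc, hq]
    omega
  · refine ⟨by omega, fun t => ?_⟩
    have := sum_erase _ (fun x => x - t) _ hv
    simp only [exc, hq, Multiset.map_cons, Multiset.sum_cons]
    omega
  · refine ⟨by omega, fun t => ?_⟩
    have := sum_erase _ (fun x => x - t) _ hA
    have := sum_erase _ (fun x => x - t) _ hB
    simp only [exc, hq]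
    omega

lemma exc_block (h a b : ℕ) (tau p : BPartition) (H : BarPositions h tau p a b) :
    h ≤ 2 * a ∧ h ≤ 2 * b ∧ ∀ t, exc p t + (a - h - t) + (b - h - t) =
      exc tau t + (a - t) + (h - a - t) + (b - t) + (h - b - t) := by
  obtain ⟨hab, nu, v, w, s1, s2, e⟩ := H
  obtain ⟨c1, s1⟩ := exc_step _ _ _ _ s1
  obtain ⟨c2, s2⟩ := exc_step _ _ _ _ s2
  have e' : (a = v ∧ b = w) ∨ (a = w ∧ b = v) := by
    have ha : a = v ∨ a = w := by
      have : a ∈ ({v, w} : Multiset ℕ) := by rw [← e]; simp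
      simpa using this
    have hs : a + b = v + w := by simpa using congrArg Multiset.sum e
    omega
  obtain ⟨rfl, rfl⟩ | ⟨rfl, rfl⟩ := e'
  · refine ⟨c1, c2, fun t => ?_⟩
    have := s1 t
    have := s2 t
    omega
  · refine ⟨c2, c1, fun t => ?_⟩
    have := s1 t
    have := s2 t
    omega

lemma bar_mono (h v w t : ℕ) (h1 : h ≤ 2 * v) (h2 : v ≤ w) :
    (v - t) + (h - v - t) + (w - h - t) ≤ (w - t) + (h - w - t) + (v - h - t) := by
  omega

end BPartition

open BPartition in
/-- For λ, μ ∈ P_{τ,2}: if a(λ) ≤ a(μ) and b(λ) ≤ b(μ) then λ ⊴ μ. -/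
theorem stmt11 (n h : ℕ) (hn : 1 ≤ n) (hh : h = 2 * n + 1)
    (tau lam mu : BPartition) (h1 : InBlock h tau 2 lam) (h2 : InBlock h tau 2 mu)
    (a₁ b₁ a₂ b₂ : ℕ) (hb1 : BarPositions h tau lam a₁ b₁)
    (hb2 : BarPositions h tau mu a₂ b₂)
    (ha : a₁ ≤ a₂) (hb : b₁ ≤ b₂) :
    domLE lam mu := by
  obtain ⟨c1, c2, e1⟩ := exc_block _ _ _ _ _ hb1
  obtain ⟨-, -, e2⟩ := exc_block _ _ _ _ _ hb2
  apply domLE_of_exc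
  intro t
  have := e1 t
  have := e2 t
  have := bar_mono h a₁ a₂ t c1 ha
  have := bar_mono h b₁ b₂ t c2 hb
  omega
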